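/- Let 𝒜 be a hereditary abelian category with exact structure ℰ. If 𝒞 ⊆ 𝒜 is ℰ-adapted (Ext¹(X,Y) ⊆ ℰ for all X,Y ∈ 𝒞), then the closure GS_ℰ(𝒞) of 𝒞 under taking kernels of ℰ-epimorphisms out of objects of the category and cokernels of ℰ-monomorphisms into objects of the category is again ℰ-adapted. -/

import Mathlib

open CategoryTheory Limits

universe v u

variable {C : Type u} [Category.{v} C] [Abelian C]

/-- `f` is an admissible monomorphism for the class `ses` of short exact sequences:
it fits as the mono of some kernel–cokernel pair in `ses`. -/
def IsAdmMono (ses : Set (ShortComplex C)) {X Y : C} (f : X ⟶ Y) : Prop :=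
  ∃ (Z : C) (g : Y ⟶ Z) (w : f ≫ g = 0), ShortComplex.mk f g w ∈ ses

/-- `g` is an admissible epimorphism for the class `ses` of short exact sequences. -/
def IsAdmEpi (ses : Set (ShortComplex C)) {Y Z : C} (g : Y ⟶ Z) : Prop :=
  ∃ (X : C) (f : X ⟶ Y) (w : f ≫ g = 0), ShortComplex.mk f g w ∈ ses

/-- A Quillen exact structure on the abelian category `C`: a class of short exact
sequences (kernel–cokernel pairs), closed under isomorphism, containing the split
short exact sequences, with admissible monomorphisms and epimorphisms closed under
composition, and stable under pushout along arbitrary morphisms (for admissible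
monos) and pullback along arbitrary morphisms (for admissible epis). -/
structure ExactStructure (C : Type u) [Category.{v} C] [Abelian C] where
  ses : Set (ShortComplex C)
  shortExact : ∀ S ∈ ses, S.ShortExact
  iso_mem : ∀ S T : ShortComplex C, (S ≅ T) → S ∈ ses → T ∈ ses
  split_mem : ∀ S : ShortComplex C, Nonempty S.Splitting → S ∈ ses
  admMono_comp : ∀ {X Y Z : C} {f : X ⟶ Y} {g : Y ⟶ Z},
    IsAdmMono ses f → IsAdmMono ses g → IsAdmMono ses (f ≫ g)
  admEpi_comp : ∀ {X Y Z : C} {f : X ⟶ Y} {g : Y ⟶ Z},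
    IsAdmEpi ses f → IsAdmEpi ses g → IsAdmEpi ses (f ≫ g)
  admMono_pushout : ∀ {X Y D : C} (f : X ⟶ Y) (h : X ⟶ D),
    IsAdmMono ses f → IsAdmMono ses (pushout.inr f h)
  admEpi_pullback : ∀ {Y Z W : C} (g : Y ⟶ Z) (h : W ⟶ Z),
    IsAdmEpi ses g → IsAdmEpi ses (pullback.snd g h)

/-- Membership in `GS_ℰ(𝒞)`: the smallest class of objects containing `𝒞`, closed
under sums and summands, under `ℰ`-quotients (cokernels of `ℰ`-monomorphisms into
objects of the class) and under `ℰ`-subobjects (kernels of `ℰ`-epimorphisms out of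
objects of the class). -/
inductive GSmem (ℰ : ExactStructure C) (𝒞 : Set C) : C → Prop
  | base {X : C} : X ∈ 𝒞 → GSmem ℰ 𝒞 X
  | quot (S : ShortComplex C) (hS : S ∈ ℰ.ses) : GSmem ℰ 𝒞 S.X₂ → GSmem ℰ 𝒞 S.X₃
  | sub (S : ShortComplex C) (hS : S ∈ ℰ.ses) : GSmem ℰ 𝒞 S.X₂ → GSmem ℰ 𝒞 S.X₁
  | prod {X Y : C} : GSmem ℰ 𝒞 X → GSmem ℰ 𝒞 Y → GSmem ℰ 𝒞 (X ⊞ Y)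
  | smd {X Y : C} (s : Y ⟶ X) (r : X ⟶ Y) (h : s ≫ r = 𝟙 Y) : GSmem ℰ 𝒞 X → GSmem ℰ 𝒞 Y

section ShortExactSquares

variable {E X Y : C}

/-- The pullback of a short exact sequence is short exact. -/
lemma exists_shortExact_of_isPullback {i : Y ⟶ E} {p : E ⟶ X} {w : i ≫ p = 0}
    (hS : (ShortComplex.mk i p w).ShortExact) {P X' : C} {f : P ⟶ E} {p' : P ⟶ X'} {h : X' ⟶ X}
    (sq : IsPullback f p' p h) :
    ∃ (i' : Y ⟶ P) (w' : i' ≫ p' = 0), i' ≫ f = i ∧ (ShortComplex.mk i' p' w').ShortExact := by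
  have : Mono i := hS.mono_f
  have : Epi p := hS.epi_g
  have hf : sq.lift i 0 (by simp [w]) ≫ f = i := sq.lift_fst ..
  have w' : sq.lift i 0 (by simp [w]) ≫ p' = 0 := sq.lift_snd ..
  have hm : Mono (sq.lift i 0 (by simp [w])) := by
    have : Mono (sq.lift i 0 (by simp [w]) ≫ f) := by rwa [hf]
    exact mono_of_mono _ f
  have he : Epi p' := by
    have : p' = sq.isoPullback.hom ≫ pullback.snd p h := by simp
    rw [this]; infer_instance
  refine ⟨_, w', hf, ?_⟩
  refine { exact := ShortComplex.exact_of_f_is_kernel _ ?_, mono_f := hm, epi_g := he }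
  refine KernelFork.IsLimit.ofι' _ _ (fun {T} k hk => ⟨hS.exact.lift (k ≫ f) ?_, ?_⟩)
  · simp [sq.w, reassoc_of% hk]
  · apply sq.hom_ext
    · simpa [hf] using hS.exact.lift_f (k ≫ f) _
    · simp [hk, w']

/-- The pushout of a short exact sequence is short exact. -/
lemma exists_shortExact_of_isPushout {i : Y ⟶ E} {p : E ⟶ X} {w : i ≫ p = 0}
    (hS : (ShortComplex.mk i p w).ShortExact) {Q Y' : C} {f : E ⟶ Q} {i' : Y' ⟶ Q} {h : Y ⟶ Y'}
    (sq : IsPushout i h f i') :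
    ∃ (p' : Q ⟶ X) (w' : i' ≫ p' = 0), f ≫ p' = p ∧ (ShortComplex.mk i' p' w').ShortExact := by
  have : Mono i := hS.mono_f
  have : Epi p := hS.epi_g
  have hf : f ≫ sq.desc p 0 (by simp [w]) = p := sq.inl_desc ..
  have w' : i' ≫ sq.desc p 0 (by simp [w]) = 0 := sq.inr_desc ..
  have he : Epi (sq.desc p 0 (by simp [w])) := by
    have : Epi (f ≫ sq.desc p 0 (by simp [w])) := by rwa [hf]
    exact epi_of_epi f _
  have hm : Mono i' := by
    have : i' = pushout.inr i h ≫ sq.isoPushout.inv := by simp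
    rw [this]; infer_instance
  refine ⟨_, w', hf, ?_⟩
  refine { exact := ShortComplex.exact_of_g_is_cokernel _ ?_, mono_f := hm, epi_g := he }
  refine CokernelCofork.IsColimit.ofπ' _ _ (fun {T} k hk => ⟨hS.exact.desc (f ≫ k) ?_, ?_⟩)
  · simp [sq.w_assoc, hk]
  · apply sq.hom_ext
    · simpa [reassoc_of% hf] using hS.exact.g_desc (f ≫ k) _
    · simp [hk, reassoc_of% w']

lemma isPullback_biprod_map_id {g : Y ⟶ X} (A : C) :
    IsPullback biprod.fst (biprod.map g (𝟙 A)) g biprod.fst :=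
  ⟨⟨by simp⟩, ⟨PullbackCone.IsLimit.mk _ (fun s => biprod.lift s.fst (s.snd ≫ biprod.snd))
    (by simp) (fun s => by ext <;> simp [s.condition])
    (fun s m h₁ h₂ => by ext <;> simp [← h₁, ← h₂])⟩⟩

lemma isPullback_biprod_id_map {g : Y ⟶ X} (A : C) :
    IsPullback biprod.snd (biprod.map (𝟙 A) g) g biprod.snd :=
  ⟨⟨by simp⟩, ⟨PullbackCone.IsLimit.mk _ (fun s => biprod.lift (s.snd ≫ biprod.fst) s.fst)
    (by simp) (fun s => by ext <;> simp [s.condition])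
    (fun s m h₁ h₂ => by ext <;> simp [← h₁, ← h₂])⟩⟩

lemma isPullback_biprod_inl_map_id {g : Y ⟶ X} (A : C) :
    IsPullback biprod.inl g (biprod.map g (𝟙 A)) biprod.inl :=
  ⟨⟨by simp⟩, ⟨PullbackCone.IsLimit.mk _ (fun s => s.fst ≫ biprod.fst)
    (fun s => by
      have := s.condition =≫ biprod.snd
      ext <;> simp_all)
    (fun s => by simpa using s.condition =≫ biprod.fst)
    (fun s m h₁ h₂ => by simp [← h₁])⟩⟩

lemma isPushout_biprod_map_id {f : X ⟶ Y} (A : C) :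
    IsPushout f biprod.inl biprod.inl (biprod.map f (𝟙 A)) :=
  ⟨⟨by simp⟩, ⟨PushoutCocone.IsColimit.mk _ (fun s => biprod.desc s.inl (biprod.inr ≫ s.inr))
    (by simp) (fun s => by ext <;> simp [s.condition])
    (fun s m h₁ h₂ => by ext <;> simp [← h₁, ← h₂])⟩⟩

lemma isPushout_biprod_id_map {f : X ⟶ Y} (A : C) :
    IsPushout f biprod.inr biprod.inr (biprod.map (𝟙 A) f) :=
  ⟨⟨by simp⟩, ⟨PushoutCocone.IsColimit.mk _ (fun s => biprod.desc (biprod.inl ≫ s.inr) s.inl)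
    (by simp) (fun s => by ext <;> simp [s.condition])
    (fun s m h₁ h₂ => by ext <;> simp [← h₁, ← h₂])⟩⟩

lemma isPushout_biprod_map_id_fst {f : X ⟶ Y} (A : C) :
    IsPushout (biprod.map f (𝟙 A)) biprod.fst biprod.fst f :=
  ⟨⟨by simp⟩, ⟨PushoutCocone.IsColimit.mk _ (fun s => biprod.inl ≫ s.inl)
    (fun s => by
      have := biprod.inr ≫= s.condition
      ext <;> simp_all)
    (fun s => by simpa using biprod.inl ≫= s.condition)
    (fun s m h₁ h₂ => by simp [← h₁])⟩⟩

end ShortExactSquares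

namespace ExactStructure

variable (ℰ : ExactStructure C) {A B X Y Z : C}

section

variable {ℰ}

lemma mem_of_isAdmEpi {S : ShortComplex C} (hS : S.ShortExact) (h : IsAdmEpi ℰ.ses S.g) :
    S ∈ ℰ.ses := by
  obtain ⟨K, f, w, hf⟩ := h
  have hf' := ℰ.shortExact _ hf
  let e : K ≅ S.X₁ := IsLimit.conePointUniqueUpToIso hf'.fIsKernel hS.fIsKernel
  have he : e.hom ≫ S.f = f :=
    IsLimit.conePointUniqueUpToIso_hom_comp hf'.fIsKernel hS.fIsKernel WalkingParallelPair.zero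
  exact ℰ.iso_mem (.mk f S.g w) S
    (ShortComplex.isoMk e (Iso.refl _) (Iso.refl _) (by simp [he])) hf

lemma mem_of_isAdmMono {S : ShortComplex C} (hS : S.ShortExact) (h : IsAdmMono ℰ.ses S.f) :
    S ∈ ℰ.ses := by
  obtain ⟨K, g, w, hg⟩ := h
  have hg' := ℰ.shortExact _ hg
  let e : K ≅ S.X₃ := IsColimit.coconePointUniqueUpToIso hg'.gIsCokernel hS.gIsCokernel
  have he : g ≫ e.hom = S.g :=
    IsColimit.comp_coconePointUniqueUpToIso_hom hg'.gIsCokernel hS.gIsCokernel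
      WalkingParallelPair.one
  exact ℰ.iso_mem (.mk S.f g w) S
    (ShortComplex.isoMk (Iso.refl _) (Iso.refl _) e (by simp) (by simp [he])) hg

lemma isAdmEpi_g {S : ShortComplex C} (hS : S ∈ ℰ.ses) : IsAdmEpi ℰ.ses S.g :=
  ⟨_, S.f, S.zero, hS⟩

lemma isAdmMono_f {S : ShortComplex C} (hS : S ∈ ℰ.ses) : IsAdmMono ℰ.ses S.f :=
  ⟨_, S.g, S.zero, hS⟩

end

lemma isAdmEpi_of_splitEpi {s : X ⟶ Y} {r : Y ⟶ X} (h : s ≫ r = 𝟙 X) : IsAdmEpi ℰ.ses r :=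
  ⟨_, kernel.ι r, kernel.condition r, ℰ.split_mem _
    ⟨.ofExactOfSection _ (ShortComplex.exact_of_f_is_kernel _ (kernelIsKernel r)) s h
      inferInstance⟩⟩

lemma isAdmMono_of_splitMono {s : X ⟶ Y} {r : Y ⟶ X} (h : s ≫ r = 𝟙 X) : IsAdmMono ℰ.ses s :=
  ⟨_, cokernel.π s, cokernel.condition s, ℰ.split_mem _
    ⟨.ofExactOfRetraction _ (ShortComplex.exact_of_g_is_cokernel _ (cokernelIsCokernel s)) r h
      inferInstance⟩⟩

variable {ℰ}

lemma isAdmEpi_of_isPullback {P : C} {f : P ⟶ Y} {g' : P ⟶ Z} {g : Y ⟶ X} {h : Z ⟶ X}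
    (sq : IsPullback f g' g h) (hg : IsAdmEpi ℰ.ses g) : IsAdmEpi ℰ.ses g' := by
  rw [← sq.isoPullback_hom_snd]
  exact ℰ.admEpi_comp (ℰ.isAdmEpi_of_splitEpi sq.isoPullback.inv_hom_id)
    (ℰ.admEpi_pullback g h hg)

lemma isAdmMono_of_isPushout {P : C} {f : X ⟶ Y} {h : X ⟶ Z} {g : Y ⟶ P} {f' : Z ⟶ P}
    (sq : IsPushout f h g f') (hf : IsAdmMono ℰ.ses f) : IsAdmMono ℰ.ses f' := by
  rw [← sq.inr_isoPushout_inv]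
  exact ℰ.admMono_comp (ℰ.admMono_pushout f h hf)
    (ℰ.isAdmMono_of_splitMono sq.isoPushout.inv_hom_id)

lemma isAdmEpi_biprod_map {g : X ⟶ Y} {g' : A ⟶ B} (hg : IsAdmEpi ℰ.ses g)
    (hg' : IsAdmEpi ℰ.ses g') : IsAdmEpi ℰ.ses (biprod.map g g') := by
  have : biprod.map g g' = biprod.map g (𝟙 A) ≫ biprod.map (𝟙 Y) g' := by ext <;> simp
  rw [this]
  exact ℰ.admEpi_comp (isAdmEpi_of_isPullback (isPullback_biprod_map_id _) hg)
    (isAdmEpi_of_isPullback (isPullback_biprod_id_map _) hg')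

lemma isAdmMono_biprod_map {g : X ⟶ Y} {g' : A ⟶ B} (hg : IsAdmMono ℰ.ses g)
    (hg' : IsAdmMono ℰ.ses g') : IsAdmMono ℰ.ses (biprod.map g g') := by
  have : biprod.map g g' = biprod.map g (𝟙 A) ≫ biprod.map (𝟙 Y) g' := by ext <;> simp
  rw [this]
  exact ℰ.admMono_comp (isAdmMono_of_isPushout (isPushout_biprod_map_id _) hg)
    (isAdmMono_of_isPushout (isPushout_biprod_id_map _) hg')

lemma isAdmEpi_of_biprod_fst_comp {g : X ⟶ Y} (h : IsAdmEpi ℰ.ses (biprod.fst (Y := A) ≫ g)) :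
    IsAdmEpi ℰ.ses g := by
  have : Epi g := by
    obtain ⟨_, _, _, h⟩ := h
    have : Epi (biprod.fst (Y := A) ≫ g) := (ℰ.shortExact _ h).epi_g
    exact epi_of_epi (biprod.fst (Y := A)) g
  have w : biprod.map (kernel.ι g) (𝟙 A) ≫ biprod.fst ≫ g = 0 := by ext <;> simp
  have hm : Mono (biprod.map (kernel.ι g) (𝟙 A)) := inferInstance
  have hS : (ShortComplex.mk _ _ w).ShortExact :=
    { exact := ShortComplex.exact_of_f_is_kernel _ (KernelFork.IsLimit.ofι' _ _
        (fun {T} k hk => ⟨biprod.lift (kernel.lift g (k ≫ biprod.fst) (by simpa using hk))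
          (k ≫ biprod.snd), by ext <;> simp⟩))
      mono_f := hm
      epi_g := epi_comp _ _ }
  have hk : IsAdmMono ℰ.ses (kernel.ι g) :=
    isAdmMono_of_isPushout (isPushout_biprod_map_id_fst A) (isAdmMono_f (mem_of_isAdmEpi hS h))
  have hS' : (ShortComplex.mk _ _ (kernel.condition g)).ShortExact :=
    { exact := ShortComplex.exact_of_f_is_kernel _ (kernelIsKernel g)
      mono_f := inferInstance
      epi_g := this }
  exact isAdmEpi_g (mem_of_isAdmMono hS' hk)

lemma isAdmMono_of_comp_biprod_inl {g : Y ⟶ X} (h : IsAdmMono ℰ.ses (g ≫ biprod.inl (Y := A))) :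
    IsAdmMono ℰ.ses g := by
  have : Mono g := by
    obtain ⟨_, _, _, h⟩ := h
    have : Mono (g ≫ biprod.inl (Y := A)) := (ℰ.shortExact _ h).mono_f
    exact mono_of_mono g (biprod.inl (Y := A))
  have w : (g ≫ biprod.inl) ≫ biprod.map (cokernel.π g) (𝟙 A) = 0 := by ext <;> simp
  have he : Epi (biprod.map (cokernel.π g) (𝟙 A)) := inferInstance
  have hS : (ShortComplex.mk _ _ w).ShortExact :=
    { exact := ShortComplex.exact_of_g_is_cokernel _ (CokernelCofork.IsColimit.ofπ' _ _
        (fun {T} k hk => ⟨biprod.desc (cokernel.desc g (biprod.inl ≫ k) (by simpa using hk))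
          (biprod.inr ≫ k), by ext <;> simp⟩))
      mono_f := mono_comp _ _
      epi_g := he }
  have hk : IsAdmEpi ℰ.ses (cokernel.π g) :=
    isAdmEpi_of_isPullback (isPullback_biprod_inl_map_id A) (isAdmEpi_g (mem_of_isAdmMono hS h))
  have hS' : (ShortComplex.mk _ _ (cokernel.condition g)).ShortExact :=
    { exact := ShortComplex.exact_of_g_is_cokernel _ (cokernelIsCokernel g)
      mono_f := this
      epi_g := inferInstance }
  exact isAdmMono_f (mem_of_isAdmEpi hS' hk)

/-- Quillen's obscure axiom: if `f ≫ g` is an admissible epimorphism, then so is `g`. -/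
lemma isAdmEpi_of_comp {f : X ⟶ Y} {g : Y ⟶ Z} (h : IsAdmEpi ℰ.ses (f ≫ g)) :
    IsAdmEpi ℰ.ses g := by
  have h₁ : IsAdmEpi ℰ.ses (biprod.map (𝟙 Y) (f ≫ g)) :=
    isAdmEpi_biprod_map (ℰ.isAdmEpi_of_splitEpi (Category.id_comp _)) h
  have h₂ : IsAdmEpi ℰ.ses (biprod.desc g (𝟙 Z)) :=
    ℰ.isAdmEpi_of_splitEpi (s := biprod.inr) (by simp)
  have h₃ : IsAdmEpi ℰ.ses (biprod.desc biprod.inl (biprod.inr - f ≫ biprod.inl) :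
      Y ⊞ X ⟶ Y ⊞ X) :=
    ℰ.isAdmEpi_of_splitEpi (s := biprod.desc biprod.inl (biprod.inr + f ≫ biprod.inl))
      (by ext <;> simp)
  refine isAdmEpi_of_biprod_fst_comp (A := X) ?_
  convert ℰ.admEpi_comp h₃ (ℰ.admEpi_comp h₁ h₂) using 1
  ext <;> simp

/-- Quillen's obscure axiom: if `f ≫ g` is an admissible monomorphism, then so is `f`. -/
lemma isAdmMono_of_comp {f : X ⟶ Y} {g : Y ⟶ Z} (h : IsAdmMono ℰ.ses (f ≫ g)) :
    IsAdmMono ℰ.ses f := by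
  have h₁ : IsAdmMono ℰ.ses (biprod.map (𝟙 Y) (f ≫ g)) :=
    isAdmMono_biprod_map (ℰ.isAdmMono_of_splitMono (Category.id_comp _)) h
  have h₂ : IsAdmMono ℰ.ses (biprod.lift f (𝟙 X)) :=
    ℰ.isAdmMono_of_splitMono (r := biprod.snd) (by simp)
  have h₃ : IsAdmMono ℰ.ses (biprod.lift biprod.fst (biprod.snd - biprod.fst ≫ g) :
      Y ⊞ Z ⟶ Y ⊞ Z) :=
    ℰ.isAdmMono_of_splitMono (r := biprod.lift biprod.fst (biprod.snd + biprod.fst ≫ g))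
      (by ext <;> simp)
  refine isAdmMono_of_comp_biprod_inl (A := Z) ?_
  convert ℰ.admMono_comp h₂ (ℰ.admMono_comp h₁ h₃) using 1
  ext <;> simp

end ExactStructure

section Realization

open DerivedCategory Pretriangulated

universe w'

/-- A short complex in `C` whose image in the derived category extends to a distinguished
triangle is short exact. -/
lemma shortExact_of_distTriang [HasDerivedCategory.{w'} C] {B F D : C} {i : B ⟶ F} {p : F ⟶ D}
    {ξ : (singleFunctor C 0).obj D ⟶ ((singleFunctor C 0).obj B)⟦(1 : ℤ)⟧}
    (hT : Triangle.mk ((singleFunctor C 0).map i) ((singleFunctor C 0).map p) ξ ∈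
      distTriang (DerivedCategory C)) :
    ∃ w : i ≫ p = 0, (ShortComplex.mk i p w).ShortExact := by
  have w : i ≫ p = 0 := (singleFunctor C 0).map_injective
    (((singleFunctor C 0).map_comp i p).trans
      ((comp_distTriang_mor_zero₁₂ _ hT).trans ((singleFunctor C 0).map_zero _ _).symm))
  refine ⟨w, ?_⟩
  let e := (ShortComplex.mk i p w).mapNatIso (singleFunctorCompHomologyFunctorIso C 0)
  refine ShortComplex.shortExact_of_iso e ?_
  have hm := (HomologySequence.mono_homologyMap_mor₁_iff _ hT (-1) 0).2
    ((isZero_of_isGE ((singleFunctor C 0).obj D) 0 (-1) (by lia)).eq_of_src _ _)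
  have he := (HomologySequence.epi_homologyMap_mor₂_iff _ hT 0 1).2
    ((isZero_of_isLE ((singleFunctor C 0).obj B) 0 1 (by lia)).eq_of_tgt _ _)
  exact { exact := HomologySequence.exact₂ _ hT 0, mono_f := hm, epi_g := he }

/-- Every morphism `D ⟶ B⟦1⟧` in the derived category comes from a short exact sequence. -/
lemma exists_shortExact_distTriang [HasDerivedCategory.{w'} C] {B D : C}
    (ξ : (singleFunctor C 0).obj D ⟶ ((singleFunctor C 0).obj B)⟦(1 : ℤ)⟧) :
    ∃ (F : C) (i : B ⟶ F) (p : F ⟶ D) (w : i ≫ p = 0), (ShortComplex.mk i p w).ShortExact ∧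
      Triangle.mk ((singleFunctor C 0).map i) ((singleFunctor C 0).map p) ξ ∈
        distTriang (DerivedCategory C) := by
  obtain ⟨F', i', p', hT⟩ := distinguished_cocone_triangle₂ ξ
  have : F'.IsGE 0 := TStructure.t.isGE₂ _ hT 0
    (inferInstanceAs (((singleFunctor C 0).obj B).IsGE 0))
    (inferInstanceAs (((singleFunctor C 0).obj D).IsGE 0))
  have : F'.IsLE 0 := TStructure.t.isLE₂ _ hT 0
    (inferInstanceAs (((singleFunctor C 0).obj B).IsLE 0))
    (inferInstanceAs (((singleFunctor C 0).obj D).IsLE 0))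
  obtain ⟨F, ⟨e⟩⟩ := exists_iso_singleFunctor_obj_of_isGE_of_isLE F' 0
  obtain ⟨i, hi⟩ := (singleFunctor C 0).map_surjective (i' ≫ e.hom)
  obtain ⟨p, hp⟩ := (singleFunctor C 0).map_surjective (e.inv ≫ p')
  have hT' : Triangle.mk ((singleFunctor C 0).map i) ((singleFunctor C 0).map p) ξ ∈
      distTriang (DerivedCategory C) :=
    isomorphic_distinguished _ hT _
      (Triangle.isoMk _ _ (Iso.refl _) e.symm (Iso.refl _)
        (by
          change (singleFunctor C 0).map i ≫ e.inv = 𝟙 ((singleFunctor C 0).obj B) ≫ i'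
          simp [hi])
        (by
          change (singleFunctor C 0).map p ≫ 𝟙 ((singleFunctor C 0).obj D) = e.inv ≫ p'
          simp [hp])
        (by
          change ξ ≫ (shiftFunctor _ (1 : ℤ)).map (𝟙 ((singleFunctor C 0).obj B)) =
            𝟙 ((singleFunctor C 0).obj D) ≫ ξ
          simp))
  obtain ⟨w, hS⟩ := shortExact_of_distTriang hT'
  exact ⟨F, i, p, w, hS, hT'⟩

open Abelian

universe w

/-- If the Yoneda product of two composable extensions vanishes, then
they fit in a common filtration: the middle term `F` is an extension both of `D` by `B` and
of `N` by `A`. -/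
lemma exists_common_extension [HasExt.{w} C] {A B M N D : C}
    {a : A ⟶ B} {b : B ⟶ M} {w₁ : a ≫ b = 0} (h₁ : (ShortComplex.mk a b w₁).ShortExact)
    {m : M ⟶ N} {n : N ⟶ D} {w₂ : m ≫ n = 0} (h₂ : (ShortComplex.mk m n w₂).ShortExact)
    (h : h₂.extClass.comp h₁.extClass (rfl : 1 + 1 = 2) = (0 : Ext.{w} D A 2)) :
    ∃ (F : C) (i : B ⟶ F) (c : F ⟶ N) (wi : i ≫ c ≫ n = 0) (wc : (a ≫ i) ≫ c = 0),
      (ShortComplex.mk i (c ≫ n) wi).ShortExact ∧ (ShortComplex.mk (a ≫ i) c wc).ShortExact ∧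
      IsPullback i b c m ∧ IsPushout i b c m := by
  let := HasDerivedCategory.standard C
  obtain ⟨ξ, hξ⟩ := Ext.covariant_sequence_exact₃ D h₁ h₂.extClass rfl h
  obtain ⟨F, i, p, wip, hF, hT⟩ := exists_shortExact_distTriang ξ.hom
  have hξ' : ξ.hom ≫ ((singleFunctor C 0).map b)⟦(1 : ℤ)⟧' = h₂.singleδ := by
    refine Eq.trans ?_ h₂.extClass_hom
    simpa [ShiftedHom.comp_mk₀] using congr_arg Ext.hom hξ
  obtain ⟨c', hc₁, hc₂⟩ := complete_distinguished_triangle_morphism₂ _ _ hT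
    h₂.singleTriangle_distinguished ((singleFunctor C 0).map b) (𝟙 _)
    (hξ'.trans (Category.id_comp _).symm)
  obtain ⟨c : F ⟶ N, rfl⟩ := (singleFunctor C 0).map_surjective c'
  have sq : i ≫ c = b ≫ m := (singleFunctor C 0).map_injective
    (((singleFunctor C 0).map_comp i c).trans
      (hc₁.trans ((singleFunctor C 0).map_comp b m).symm))
  obtain rfl : p = c ≫ n := (singleFunctor C 0).map_injective
    ((Category.comp_id _).symm.trans (hc₂.trans ((singleFunctor C 0).map_comp c n).symm))
  have : Mono a := h₁.mono_f
  have : Epi b := h₁.epi_g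
  have : Mono m := h₂.mono_f
  have : Epi n := h₂.epi_g
  have : Mono i := hF.mono_f
  have : Epi (c ≫ n) := hF.epi_g
  have wc : (a ≫ i) ≫ c = 0 := by simp [sq, reassoc_of% w₁]
  have hpb : IsPullback i b c m := ⟨⟨sq⟩, ⟨PullbackCone.IsLimit.mk _
    (fun s => hF.exact.lift s.fst (by simp [reassoc_of% s.condition, w₂]))
    (fun s => hF.exact.lift_f _ _)
    (fun s => by
      rw [← cancel_mono m, Category.assoc, ← sq]
      exact (hF.exact.lift_f_assoc _ _ _).trans s.condition)
    (fun s k hk _ => by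
      rw [← cancel_mono i, hk]
      exact (hF.exact.lift_f _ _).symm)⟩⟩
  have hc : Epi c := by
    rw [Preadditive.epi_iff_cancel_zero]
    intro T f hf
    have hmf : m ≫ f = 0 := by rw [← cancel_epi b, ← reassoc_of% sq, hf]; simp
    obtain ⟨g, rfl⟩ := h₂.exact.desc' f hmf
    obtain rfl : g = 0 := by rw [← cancel_epi (c ≫ n)]; simpa using hf
    simp
  have hSc : (ShortComplex.mk (a ≫ i) c wc).ShortExact :=
    { exact := ShortComplex.exact_of_f_is_kernel _ (KernelFork.IsLimit.ofι' _ _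
        (fun {T} k hk => ⟨h₁.exact.lift (hpb.lift k 0 (by simpa using hk)) (by simp), by
          have := h₁.exact.lift_f (hpb.lift k 0 (by simpa using hk)) (by simp)
          simp only [← Category.assoc]
          exact (congr_arg (· ≫ i) this).trans (by simp)⟩))
      mono_f := mono_comp _ _
      epi_g := hc }
  refine ⟨F, i, c, wip, wc, hF, hSc, hpb, ⟨⟨sq⟩, ⟨PushoutCocone.IsColimit.mk _
    (fun s => hSc.exact.desc s.inl (by simp [s.condition, reassoc_of% w₁]))
    (fun s => hSc.exact.g_desc _ _)
    (fun s => by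
      rw [← cancel_epi b, ← reassoc_of% sq]
      exact (congr_arg (i ≫ ·) (hSc.exact.g_desc _ _)).trans s.condition)
    (fun s k hk _ => by
      rw [← cancel_epi c, hk]
      exact (hSc.exact.g_desc _ _).symm)⟩⟩⟩

end Realization

section Adapted

/-- Every extension of `X` by `Y` belongs to the exact structure `ℰ`. -/
def ExtAdapted (ℰ : ExactStructure C) (X Y : C) : Prop :=
  ∀ ⦃E : C⦄ (i : Y ⟶ E) (p : E ⟶ X) (w : i ≫ p = 0),
    (ShortComplex.mk i p w).ShortExact → ShortComplex.mk i p w ∈ ℰ.ses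

namespace ExtAdapted

open ExactStructure Abelian

universe w

variable {ℰ : ExactStructure C} {X X' Y Y' : C}

lemma of_isAdmEpi_left {g : X ⟶ X'} (hg : IsAdmEpi ℰ.ses g) (h : ExtAdapted ℰ X Y) :
    ExtAdapted ℰ X' Y := by
  intro E i p w hS
  have sq := IsPullback.of_hasPullback p g
  obtain ⟨i', w', -, hS'⟩ := exists_shortExact_of_isPullback hS sq
  refine mem_of_isAdmEpi hS (isAdmEpi_of_comp (f := pullback.fst p g) ?_)
  rw [sq.w]
  exact ℰ.admEpi_comp (isAdmEpi_g (h _ _ w' hS')) hg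

lemma of_isAdmMono_right {f : Y' ⟶ Y} (hf : IsAdmMono ℰ.ses f) (h : ExtAdapted ℰ X Y) :
    ExtAdapted ℰ X Y' := by
  intro E i p w hS
  have sq := IsPushout.of_hasPushout i f
  obtain ⟨p', w', -, hS'⟩ := exists_shortExact_of_isPushout hS sq
  refine mem_of_isAdmMono hS (isAdmMono_of_comp (g := pushout.inl i f) ?_)
  rw [sq.w]
  exact ℰ.admMono_comp hf (isAdmMono_f (h _ _ w' hS'))

lemma biprod_left (h : ExtAdapted ℰ X Y) (h' : ExtAdapted ℰ X' Y) :
    ExtAdapted ℰ (X ⊞ X') Y := by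
  intro E i p w hS
  have sq := IsPullback.of_hasPullback p (biprod.inl : X ⟶ X ⊞ X')
  have sq' := IsPullback.of_hasPullback p (biprod.inr : X' ⟶ X ⊞ X')
  obtain ⟨i₁, w₁, -, hS₁⟩ := exists_shortExact_of_isPullback hS sq
  obtain ⟨i₂, w₂, -, hS₂⟩ := exists_shortExact_of_isPullback hS sq'
  refine mem_of_isAdmEpi hS (isAdmEpi_of_comp (f := biprod.desc
    (pullback.fst p biprod.inl) (pullback.fst p biprod.inr)) ?_)
  convert isAdmEpi_biprod_map (isAdmEpi_g (h _ _ w₁ hS₁)) (isAdmEpi_g (h' _ _ w₂ hS₂)) using 1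
  apply biprod.hom_ext'
  · simp [sq.w]
  · simp [sq'.w]

lemma biprod_right (h : ExtAdapted ℰ X Y) (h' : ExtAdapted ℰ X Y') :
    ExtAdapted ℰ X (Y ⊞ Y') := by
  intro E i p w hS
  have sq := IsPushout.of_hasPushout i (biprod.fst : Y ⊞ Y' ⟶ Y)
  have sq' := IsPushout.of_hasPushout i (biprod.snd : Y ⊞ Y' ⟶ Y')
  obtain ⟨p₁, w₁, -, hS₁⟩ := exists_shortExact_of_isPushout hS sq
  obtain ⟨p₂, w₂, -, hS₂⟩ := exists_shortExact_of_isPushout hS sq'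
  refine mem_of_isAdmMono hS (isAdmMono_of_comp (g := biprod.lift
    (pushout.inl i biprod.fst) (pushout.inl i biprod.snd)) ?_)
  convert isAdmMono_biprod_map (isAdmMono_f (h _ _ w₁ hS₁)) (isAdmMono_f (h' _ _ w₂ hS₂)) using 1
  apply biprod.hom_ext
  · simp [sq.w]
  · simp [sq'.w]

variable [HasExt.{w} C]

lemma X₁_left {S : ShortComplex C} (hS : S.ShortExact) [Subsingleton (Ext.{w} S.X₃ Y 2)]
    (h : ExtAdapted ℰ S.X₂ Y) : ExtAdapted ℰ S.X₁ Y := by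
  intro E i p w hE
  obtain ⟨F, j, c, wj, wc, -, hc, hpb, -⟩ :=
    exists_common_extension hE hS (Subsingleton.elim _ _)
  exact mem_of_isAdmEpi hE (isAdmEpi_of_isPullback hpb (isAdmEpi_g (h _ _ wc hc)))

lemma X₃_right {S : ShortComplex C} (hS : S.ShortExact) [Subsingleton (Ext.{w} X S.X₁ 2)]
    (h : ExtAdapted ℰ X S.X₂) : ExtAdapted ℰ X S.X₃ := by
  intro E i p w hE
  obtain ⟨F, j, c, wj, wc, hj, -, -, hpo⟩ :=
    exists_common_extension hS hE (Subsingleton.elim _ _)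
  exact mem_of_isAdmMono hE (isAdmMono_of_isPushout hpo (isAdmMono_f (h _ _ wj hj)))

lemma of_GSmem_left (hereditary : ∀ X Y : C, Subsingleton (Ext.{w} X Y 2)) {𝒞 : Set C}
    (h : ∀ X ∈ 𝒞, ExtAdapted ℰ X Y) (hX : GSmem ℰ 𝒞 X) : ExtAdapted ℰ X Y := by
  induction hX with
  | base hX => exact h _ hX
  | quot S hS _ ih => exact ih.of_isAdmEpi_left (isAdmEpi_g (S := S) hS)
  | sub S hS _ ih => exact X₁_left (ℰ.shortExact _ hS) ih
  | prod _ _ ih ih' => exact ih.biprod_left ih'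
  | smd s r hsr _ ih => exact ih.of_isAdmEpi_left (ℰ.isAdmEpi_of_splitEpi hsr)

lemma of_GSmem_right (hereditary : ∀ X Y : C, Subsingleton (Ext.{w} X Y 2)) {𝒞 : Set C}
    (h : ∀ Y ∈ 𝒞, ExtAdapted ℰ X Y) (hY : GSmem ℰ 𝒞 Y) : ExtAdapted ℰ X Y := by
  induction hY with
  | base hY => exact h _ hY
  | quot S hS _ ih => exact X₃_right (ℰ.shortExact _ hS) ih
  | sub S hS _ ih => exact ih.of_isAdmMono_right (isAdmMono_f (S := S) hS)
  | prod _ _ ih ih' => exact ih.biprod_right ih'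
  | smd s r hsr _ ih => exact ih.of_isAdmMono_right (ℰ.isAdmMono_of_splitMono hsr)

end ExtAdapted

end Adapted

universe w

open Abelian in
/-- let `𝒜` be a hereditary abelian category with exact structure `ℰ`.
If `𝒞 ⊆ 𝒜` is `ℰ`-adapted (every extension between objects of `𝒞` lies in `ℰ`),
then `GS_ℰ(𝒞)` is again `ℰ`-adapted. -/
theorem GS_EAdapted [HasExt.{w} C] (ℰ : ExactStructure C)
    (hereditary : ∀ X Y : C, Subsingleton (Ext.{w} X Y 2))
    (𝒞 : Set C)
    (hadapted : ∀ S : ShortComplex C, S.ShortExact → S.X₃ ∈ 𝒞 → S.X₁ ∈ 𝒞 → S ∈ ℰ.ses) :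
    ∀ S : ShortComplex C, S.ShortExact → GSmem ℰ 𝒞 S.X₃ → GSmem ℰ 𝒞 S.X₁ → S ∈ ℰ.ses := by
  intro S hS hX₃ hX₁
  have h : ExtAdapted ℰ S.X₃ S.X₁ :=
    ExtAdapted.of_GSmem_right hereditary (fun Y hY =>
      ExtAdapted.of_GSmem_left hereditary (fun X hX E i p w hE => hadapted _ hE hX hY) hX₃) hX₁
  exact h S.f S.g S.zero hS
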